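/- arXiv:2003.00413 — 2 statements merged into one kernel-verified Lean document; each statement's English description precedes it below -/
import Mathlib

section
/- Let Γ = {A ∈ SL(2,ℤ) : A = [[a,b],[c,d]] with a+c odd and b+d odd}, T = [[1,1],[0,1]] and R = [[0,-1],[1,0]]. Then every element of SL(2,ℤ) lies in exactly one of the three right cosets Γ, Γ·T, Γ·(T·R); in particular Γ has index 3 in SL(2,ℤ). -/
/-- The defining condition for the Veech group Γ of St(5) inside SL(2,ℤ):
for `A = [[a,b],[c,d]]`, both `a+c` and `b+d` are odd. -/
def VeechCond (A : Matrix.SpecialLinearGroup (Fin 2) ℤ) : Prop :=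
  Odd (A.1 0 0 + A.1 1 0) ∧ Odd (A.1 0 1 + A.1 1 1)

/-- `T = [[1,1],[0,1]]` as an element of SL(2,ℤ). -/
def Tmat : Matrix.SpecialLinearGroup (Fin 2) ℤ :=
  ⟨!![1, 1; 0, 1], by norm_num [Matrix.det_fin_two_of]⟩

/-- `R = [[0,-1],[1,0]]` as an element of SL(2,ℤ). -/
def Rmat : Matrix.SpecialLinearGroup (Fin 2) ℤ :=
  ⟨!![0, -1; 1, 0], by norm_num [Matrix.det_fin_two_of]⟩

lemma veech_aux (P : Fin 3 → Prop)
    (hk : (P 0 ∧ ¬ P 1 ∧ ¬ P 2) ∨ (¬ P 0 ∧ P 1 ∧ ¬ P 2) ∨ (¬ P 0 ∧ ¬ P 1 ∧ P 2))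
    (i j : Fin 3) (hi : P i) (hj : P j) : i = j := by
  fin_cases i <;> fin_cases j <;> first | rfl | (exfalso; simp at hi hj; tauto)

/-- Every element of SL(2,ℤ) lies in exactly one of the three right cosets
`Γ`, `Γ·T`, `Γ·(T·R)`; in particular, for any subgroup `Γ` whose carrier is the set
of matrices with `a+c` and `b+d` odd, `Γ` has index 3 in SL(2,ℤ). -/
theorem veech_group_cosets (Γ : Subgroup (Matrix.SpecialLinearGroup (Fin 2) ℤ))
    (hΓ : ∀ A, A ∈ Γ ↔ VeechCond A) :
    (∀ A : Matrix.SpecialLinearGroup (Fin 2) ℤ,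
        (A ∈ Γ ∧ A * Tmat⁻¹ ∉ Γ ∧ A * (Tmat * Rmat)⁻¹ ∉ Γ) ∨
        (A ∉ Γ ∧ A * Tmat⁻¹ ∈ Γ ∧ A * (Tmat * Rmat)⁻¹ ∉ Γ) ∨
        (A ∉ Γ ∧ A * Tmat⁻¹ ∉ Γ ∧ A * (Tmat * Rmat)⁻¹ ∈ Γ)) ∧
      Γ.index = 3 := by
  have key : ∀ A : Matrix.SpecialLinearGroup (Fin 2) ℤ,
        (A ∈ Γ ∧ A * Tmat⁻¹ ∉ Γ ∧ A * (Tmat * Rmat)⁻¹ ∉ Γ) ∨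
        (A ∉ Γ ∧ A * Tmat⁻¹ ∈ Γ ∧ A * (Tmat * Rmat)⁻¹ ∉ Γ) ∨
        (A ∉ Γ ∧ A * Tmat⁻¹ ∉ Γ ∧ A * (Tmat * Rmat)⁻¹ ∈ Γ) := by
    intro A
    have hdet : A.1 0 0 * A.1 1 1 - A.1 0 1 * A.1 1 0 = 1 := by
      rw [← Matrix.det_fin_two]; exact A.2
    have h1 : A * Tmat⁻¹ ∈ Γ ↔ Odd (A.1 0 0 + A.1 1 0) ∧
        Odd ((A.1 0 1 + A.1 1 1) - (A.1 0 0 + A.1 1 0)) := by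
      rw [hΓ, VeechCond]
      have e : (Tmat⁻¹).1 = !![1, -1; 0, 1] := by decide
      rw [show (A * Tmat⁻¹).1 = A.1 * (Tmat⁻¹).1 from rfl, e]
      simp only [Matrix.mul_apply, Fin.sum_univ_two, Matrix.of_apply, Matrix.cons_val]
      ring_nf
    have h2 : A * (Tmat * Rmat)⁻¹ ∈ Γ ↔ Odd (-(A.1 0 1 + A.1 1 1)) ∧
        Odd ((A.1 0 1 + A.1 1 1) + (A.1 0 0 + A.1 1 0)) := by
      rw [hΓ, VeechCond]
      have e : ((Tmat * Rmat)⁻¹).1 = !![0, 1; -1, 1] := by decide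
      rw [show (A * (Tmat * Rmat)⁻¹).1 = A.1 * ((Tmat * Rmat)⁻¹).1 from rfl, e]
      simp only [Matrix.mul_apply, Fin.sum_univ_two, Matrix.of_apply, Matrix.cons_val]
      ring_nf
    rw [h1, h2, hΓ, VeechCond]
    have h3 : Odd (A.1 0 0 + A.1 1 0) ∨ Odd (A.1 0 1 + A.1 1 1) := by
      by_contra! h
      simp only [Int.not_odd_iff_even] at h
      obtain ⟨⟨k, hk⟩, ⟨l, hl⟩⟩ := h
      have e0 : A.1 0 0 = k + k - A.1 1 0 := by linarith
      have e1 : A.1 0 1 = l + l - A.1 1 1 := by linarith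
      rw [e0, e1] at hdet
      have : 2 * (k * A.1 1 1 - l * A.1 1 0) = 1 := by linarith
      omega
    generalize A.1 0 0 + A.1 1 0 = s at *
    generalize A.1 0 1 + A.1 1 1 = t at *
    simp only [Int.odd_iff] at *
    omega
  refine ⟨key, ?_⟩
  let g : Fin 3 → Matrix.SpecialLinearGroup (Fin 2) ℤ := ![1, Tmat, Tmat * Rmat]
  have hb : Function.Bijective
      (fun i => (QuotientGroup.mk (g i)⁻¹ : Matrix.SpecialLinearGroup (Fin 2) ℤ ⧸ Γ)) := by
    constructor
    · intro i j hij
      have hij' : g i * (g j)⁻¹ ∈ Γ := by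
        simpa using QuotientGroup.eq.1 hij
      have hii : g i * (g i)⁻¹ ∈ Γ := by simp [Γ.one_mem]
      have hk := key (g i)
      have e0 : ∀ x, x * (g 0)⁻¹ ∈ Γ ↔ x ∈ Γ := fun x => by simp [g]
      have e1 : g 1 = Tmat := rfl
      have e2 : g 2 = Tmat * Rmat := rfl
      rw [← e2, ← e1, ← e0 (g i)] at hk
      exact veech_aux (fun k => g i * (g k)⁻¹ ∈ Γ) hk i j hii hij'
    · intro q
      induction q using QuotientGroup.induction_on with
      | H A =>
        rcases key A⁻¹ with h | h | h
        · exact ⟨0, (QuotientGroup.eq.2 (by simpa [g] using h.1)).symm⟩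
        · exact ⟨1, (QuotientGroup.eq.2 (by simpa only [g, Matrix.cons_val] using h.2.1)).symm⟩
        · exact ⟨2, (QuotientGroup.eq.2 (by simpa only [g, Matrix.cons_val] using h.2.2)).symm⟩
  rw [Subgroup.index, ← Nat.card_eq_of_bijective _ hb]
  simp
end

section
/- Let Γ = {A ∈ SL(2,ℤ) : A = [[a,b],[c,d]] with a+c odd and b+d odd}, T = [[1,1],[0,1]] and R = [[0,-1],[1,0]]. Then Γ is generated as a group by the three matrices R, T² and (T·R)·T·(T·R)⁻¹, i.e. by [[0,-1],[1,0]], [[1,2],[0,1]] and [[0,1],[-1,2]]. -/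
theorem veech_one : VeechCond 1 := by
  simp [VeechCond]

theorem veech_mul (A B : Matrix.SpecialLinearGroup (Fin 2) ℤ) (hA : VeechCond A)
    (hB : VeechCond B) : VeechCond (A * B) := by
  obtain ⟨⟨m, hm⟩, ⟨n, hn⟩⟩ := hA
  obtain ⟨⟨p, hp⟩, ⟨q, hq⟩⟩ := hB
  simp only [VeechCond, Matrix.SpecialLinearGroup.coe_mul, Matrix.mul_apply, Fin.sum_univ_two]
  constructor
  · refine ⟨m * B.1 0 0 + n * B.1 1 0 + p, ?_⟩
    linear_combination B.1 0 0 * hm + B.1 1 0 * hn + hp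
  · refine ⟨m * B.1 0 1 + n * B.1 1 1 + q, ?_⟩
    linear_combination B.1 0 1 * hm + B.1 1 1 * hn + hq

theorem veech_inv (A : Matrix.SpecialLinearGroup (Fin 2) ℤ) (hA : VeechCond A) :
    VeechCond A⁻¹ := by
  have hd := A.2
  rw [Matrix.det_fin_two] at hd
  obtain ⟨⟨m, hm⟩, ⟨n, hn⟩⟩ := hA
  simp only [VeechCond, Matrix.SpecialLinearGroup.coe_inv, Matrix.adjugate_fin_two]
  simp only [Matrix.of_apply, Matrix.cons_val', Matrix.cons_val_zero, Matrix.cons_val_one,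
    Matrix.cons_val_fin_one]
  constructor
  · refine ⟨n * A.1 1 0 - m * A.1 1 1, ?_⟩
    linear_combination A.1 1 0 * hn - A.1 1 1 * hm + hd
  · refine ⟨m * A.1 0 1 - n * A.1 0 0, ?_⟩
    linear_combination A.1 0 1 * hm - A.1 0 0 * hn + hd

theorem veech_Tpow (k : ℤ) : ((Tmat ^ 2) ^ k).1 = !![1, 2 * k; 0, 1] := by
  have h : Tmat = ModularGroup.T := rfl
  rw [h, ← zpow_natCast, ← zpow_mul]
  exact_mod_cast ModularGroup.coe_T_zpow (2 * k)

theorem veech_aux_s2 (H : Subgroup (Matrix.SpecialLinearGroup (Fin 2) ℤ)) (hR : Rmat ∈ H)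
    (hT : Tmat ^ 2 ∈ H) (n : ℕ) : ∀ A : Matrix.SpecialLinearGroup (Fin 2) ℤ,
    VeechCond A → (A.1 1 0).natAbs = n → A ∈ H := by
  induction n using Nat.strong_induction_on with
  | _ n ih =>
  intro A hA hn
  have hd := A.2
  rw [Matrix.det_fin_two] at hd
  by_cases hc : A.1 1 0 = 0
  · rw [hc, mul_zero, sub_zero] at hd
    obtain ⟨-, h2⟩ := hA
    rcases Int.mul_eq_one_iff_eq_one_or_neg_one.mp hd with ⟨h0, h1⟩ | ⟨h0, h1⟩
    · have hb : ∃ k, A.1 0 1 = 2 * k := by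
        rw [h1] at h2
        obtain ⟨k, hk⟩ := h2
        exact ⟨k, by linarith⟩
      obtain ⟨k, hk⟩ := hb
      have : A = (Tmat ^ 2) ^ k := by
        apply Subtype.ext
        rw [veech_Tpow, Matrix.eta_fin_two A.1, h0, h1, hk, hc]
      rw [this]
      exact H.zpow_mem hT k
    · have hb : ∃ k, A.1 0 1 = - (2 * k) := by
        rw [h1] at h2
        obtain ⟨k, hk⟩ := h2
        exact ⟨-k - 1, by linarith⟩
      obtain ⟨k, hk⟩ := hb
      have : A = Rmat * Rmat * (Tmat ^ 2) ^ k := by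
        apply Subtype.ext
        rw [Matrix.SpecialLinearGroup.coe_mul, Matrix.SpecialLinearGroup.coe_mul]
        rw [veech_Tpow, Matrix.eta_fin_two A.1, h0, h1, hk, hc]
        simp [Rmat]
      rw [this]
      exact H.mul_mem (H.mul_mem hR hR) (H.zpow_mem hT k)
  · have hk : ∃ k : ℤ, (A.1 0 0 + 2 * k * A.1 1 0).natAbs < n := by
      obtain ⟨⟨m, hm⟩, -⟩ := hA
      generalize A.1 0 0 = a at *
      generalize A.1 1 0 = c at *
      have e := Int.emod_add_mul_ediv (a + |c|) (2 * |c|)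
      have hp : 0 < |c| := abs_pos.mpr hc
      have l := Int.emod_nonneg (a + |c|) (b := 2 * |c|) (by omega)
      have u := Int.emod_lt_of_pos (a + |c|) (b := 2 * |c|) (by omega)
      generalize (a + |c|) % (2 * |c|) = r at *
      generalize (a + |c|) / (2 * |c|) = q at *
      rcases abs_cases c with ⟨h, h'⟩ | ⟨h, h'⟩ <;> rw [h] at e u
      · refine ⟨-q, ?_⟩
        have : a + 2 * -q * c = r - c := by linear_combination -e
        have e2 : a + 2 * (-q * c) = r - c := by linear_combination -e
        rw [this]
        omega
      · refine ⟨q, ?_⟩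
        have : a + 2 * q * c = r + c := by linear_combination -e
        have e2 : a + 2 * (q * c) = r + c := by linear_combination -e
        rw [this]
        omega
    obtain ⟨k, hk⟩ := hk
    have hRV : VeechCond Rmat := by constructor <;> simp [Rmat]
    have hTV : VeechCond ((Tmat ^ 2) ^ k) := by
      constructor <;> rw [veech_Tpow] <;> simp
    have key := ih _ hk (Rmat * ((Tmat ^ 2) ^ k * A))
      (veech_mul _ _ hRV (veech_mul _ _ hTV hA)) (by
        rw [Matrix.SpecialLinearGroup.coe_mul, Matrix.SpecialLinearGroup.coe_mul, veech_Tpow]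
        simp [Rmat, Matrix.mul_apply, Matrix.vecMul, dotProduct, Fin.sum_univ_two])
    rwa [H.mul_mem_cancel_left hR, H.mul_mem_cancel_left (H.zpow_mem hT k)] at key

/-- `Γ = {A ∈ SL(2,ℤ) : a+c odd and b+d odd}` is generated by the three matrices
`R`, `T²` and `(T·R)·T·(T·R)⁻¹`. -/
theorem veech_group_generators :
    ∀ A : Matrix.SpecialLinearGroup (Fin 2) ℤ,
      A ∈ Subgroup.closure
          ({Rmat, Tmat ^ 2, (Tmat * Rmat) * Tmat * (Tmat * Rmat)⁻¹} :
            Set (Matrix.SpecialLinearGroup (Fin 2) ℤ)) ↔ VeechCond A := by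
  intro A
  constructor
  · intro h
    induction h using Subgroup.closure_induction with
    | mem x hx =>
      rcases hx with rfl | rfl | rfl
      · constructor <;> simp [Rmat]
      · have := veech_Tpow 1
        rw [zpow_one] at this
        constructor <;> rw [this] <;> decide
      · unfold VeechCond
        decide
    | one => exact veech_one
    | mul x y _ _ hx hy => exact veech_mul x y hx hy
    | inv x _ hx => exact veech_inv x hx
  · intro h
    exact veech_aux_s2 _ (Subgroup.subset_closure (by simp)) (Subgroup.subset_closure (by simp))
      _ A h rfl
end
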